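/- Let ρ_{XB} = ∑_x P(x)|x⟩⟨x| ⊗ ρ_x be a classical-quantum state and σ_B a state. Then for α ∈ [1/2,1), Q̌_α(ρ_{XB} ‖ P_X ⊗ σ_B) = ∑_x P(x) Q̌_α(ρ_x ‖ σ_B), where Q̌_α is the measured Rényi quantity defined by optimizing ∑_j (tr[·Λ_j])^α (tr[·Λ_j])^{1−α} over projective measurements. -/

import Mathlib

open MeasureTheory Matrix Set ComplexOrder

variable {m : Type*} [Fintype m] [DecidableEq m]

/-- The integral matrix quotient `A/B := ∫₀^∞ (λ+B)⁻¹ A (λ+B)⁻¹ dλ`, defined entrywise. -/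
noncomputable def mq (A B : Matrix m m ℂ) : Matrix m m ℂ :=
  Matrix.of fun i j =>
    ∫ l in Set.Ioi (0:ℝ),
      ((l • (1 : Matrix m m ℂ) + B)⁻¹ * A * (l • (1 : Matrix m m ℂ) + B)⁻¹) i j

/-- Real power of a Hermitian matrix via the spectral decomposition (junk value `0` otherwise). -/
noncomputable def mrpow (A : Matrix m m ℂ) (r : ℝ) : Matrix m m ℂ :=
  if h : A.IsHermitian then
    (h.eigenvectorUnitary : Matrix m m ℂ) *
      Matrix.diagonal (fun i => ((h.eigenvalues i ^ r : ℝ) : ℂ)) *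
      star (h.eigenvectorUnitary : Matrix m m ℂ)
  else 0

/-- Trace norm of a Hermitian matrix: the sum of the absolute values of its eigenvalues
(junk value `0` otherwise). -/
noncomputable def traceNorm (A : Matrix m m ℂ) : ℝ :=
  if h : A.IsHermitian then ∑ i, |h.eigenvalues i| else 0

/-- Operator norm of a positive semidefinite (in particular Hermitian) matrix:
its largest eigenvalue (junk value `0` otherwise). -/
noncomputable def opNorm (A : Matrix m m ℂ) : ℝ :=
  if h : A.IsHermitian then ⨆ i, h.eigenvalues i else 0

/-- `Q₂^ι(A‖B) = tr[A (A/B)] = ∫₀^∞ tr[A (t+B)⁻¹ A (t+B)⁻¹] dt`. -/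
noncomputable def Q2iota (A B : Matrix m m ℂ) : ℝ :=
  ∫ t in Set.Ioi (0:ℝ),
    (A * (t • (1 : Matrix m m ℂ) + B)⁻¹ * A * (t • (1 : Matrix m m ℂ) + B)⁻¹).trace.re

/-- A projective measurement: a finite family of mutually orthogonal projections
summing to the identity. -/
structure PVM (m : Type*) [Fintype m] [DecidableEq m] where
  k : ℕ
  P : Fin k → Matrix m m ℂ
  herm : ∀ j, (P j).IsHermitian
  idem : ∀ j, P j * P j = P j
  orth : ∀ j j', j ≠ j' → P j * P j' = 0
  sum_eq : ∑ j, P j = 1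

/-- The value `∑_j (tr[ρΛ_j])^α (tr[σΛ_j])^{1-α}` of a projective measurement. -/
noncomputable def measVal (α : ℝ) (ρ σ : Matrix m m ℂ) (Λ : PVM m) : ℝ :=
  ∑ j, ((ρ * Λ.P j).trace.re) ^ α * ((σ * Λ.P j).trace.re) ^ (1 - α)

/-- The measured Rényi quantity `Q̌_α(ρ‖σ)`: for `α ∈ [1/2,1)` it is the infimum over
projective measurements of `∑_j (tr[ρΛ_j])^α (tr[σΛ_j])^{1-α}`. -/
noncomputable def Qmeas (α : ℝ) (ρ σ : Matrix m m ℂ) : ℝ :=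
  sInf {v | ∃ Λ : PVM m, v = measVal α ρ σ Λ}

/-- The measured Rényi divergence `Ď_α(ρ‖σ) = (α-1)⁻¹ log Q̌_α(ρ‖σ)`. -/
noncomputable def Dmeas (α : ℝ) (ρ σ : Matrix m m ℂ) : ℝ :=
  (1 / (α - 1)) * Real.log (Qmeas α ρ σ)

/-- The classical-quantum state `∑_x P(x) |x⟩⟨x| ⊗ ρ_x` as a matrix on `X × m`. -/
noncomputable def cqState {X : Type*} [Fintype X] [DecidableEq X]
    (P : X → ℝ) (ρ : X → Matrix m m ℂ) : Matrix (X × m) (X × m) ℂ :=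
  Matrix.of fun p q => if p.1 = q.1 then (P p.1 : ℂ) * ρ p.1 p.2 q.2 else 0

/-- A projective measurement indexed by an arbitrary finite type can be relabelled by `Fin k`. -/
theorem exists_pvm_measVal_eq {ι : Type*} [Fintype ι] (E : ι → Matrix m m ℂ)
    (herm : ∀ i, (E i).IsHermitian) (idem : ∀ i, E i * E i = E i)
    (orth : ∀ i j, i ≠ j → E i * E j = 0) (sum_eq : ∑ i, E i = 1) :
    ∃ Λ : PVM m, ∀ α ρ σ, measVal α ρ σ Λ =
      ∑ i, ((ρ * E i).trace.re) ^ α * ((σ * E i).trace.re) ^ (1 - α) := by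
  let e := (Fintype.equivFin ι).symm
  refine ⟨⟨Fintype.card ι, fun j => E (e j), fun _ => herm _, fun _ => idem _,
    fun _ _ h => orth _ _ (e.injective.ne h), ?_⟩, fun α ρ σ => ?_⟩
  · rw [← sum_eq]
    exact e.sum_comp E
  · exact e.sum_comp fun i => ((ρ * E i).trace.re) ^ α * ((σ * E i).trace.re) ^ (1 - α)

instance : Nonempty (PVM m) :=
  ⟨(exists_pvm_measVal_eq (fun _ : Unit => (1 : Matrix m m ℂ)) (by simp [isHermitian_one])
    (by simp) (by simp) (by simp)).choose⟩

open scoped MatrixOrder in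
theorem Matrix.PosSemidef.re_trace_mul_nonneg {A B : Matrix m m ℂ} (hA : A.PosSemidef)
    (hB : B.PosSemidef) : 0 ≤ (A * B).trace.re := by
  obtain ⟨C, rfl⟩ := CStarAlgebra.nonneg_iff_eq_star_mul_self.mp hA.nonneg
  rw [Matrix.mul_assoc, Matrix.trace_mul_comm, star_eq_conjTranspose]
  exact (Complex.nonneg_iff.mp (hB.mul_mul_conjTranspose_same C).trace_nonneg).1

theorem Matrix.IsHermitian.posSemidef_of_idem {n : Type*} [Fintype n] {E : Matrix n n ℂ}
    (hE : E.IsHermitian)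
    (h : E * E = E) : E.PosSemidef := by
  have := posSemidef_conjTranspose_mul_self E
  rwa [hE.eq, h] at this

theorem PVM.posSemidef (Λ : PVM m) (j : Fin Λ.k) : (Λ.P j).PosSemidef :=
  (Λ.herm j).posSemidef_of_idem (Λ.idem j)

theorem measVal_nonneg {ρ σ : Matrix m m ℂ} (hρ : ρ.PosSemidef) (hσ : σ.PosSemidef) (α : ℝ)
    (Λ : PVM m) : 0 ≤ measVal α ρ σ Λ :=
  Finset.sum_nonneg fun j _ => mul_nonneg
    (Real.rpow_nonneg (hρ.re_trace_mul_nonneg (Λ.posSemidef j)) _)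
    (Real.rpow_nonneg (hσ.re_trace_mul_nonneg (Λ.posSemidef j)) _)

theorem Qmeas_le_measVal {ρ σ : Matrix m m ℂ} (hρ : ρ.PosSemidef) (hσ : σ.PosSemidef) (α : ℝ)
    (Λ : PVM m) : Qmeas α ρ σ ≤ measVal α ρ σ Λ := by
  refine csInf_le ⟨0, ?_⟩ ⟨Λ, rfl⟩
  rintro _ ⟨Λ, rfl⟩
  exact measVal_nonneg hρ hσ α Λ

theorem le_Qmeas {ρ σ : Matrix m m ℂ} {α c : ℝ} (h : ∀ Λ : PVM m, c ≤ measVal α ρ σ Λ) :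
    c ≤ Qmeas α ρ σ := by
  obtain ⟨Λ⟩ := (inferInstance : Nonempty (PVM m))
  refine le_csInf ⟨_, Λ, rfl⟩ ?_
  rintro _ ⟨Λ, rfl⟩
  exact h Λ

theorem exists_measVal_lt_Qmeas_add (ρ σ : Matrix m m ℂ) (α : ℝ) {ε : ℝ} (hε : 0 < ε) :
    ∃ Λ : PVM m, measVal α ρ σ Λ < Qmeas α ρ σ + ε := by
  by_contra! h
  linarith [le_Qmeas h]

/-- The inverse is operator convex: if `R` inverts `∑ j, t j • M j` for a POVM `M`, then
`R ≤ ∑ j, (t j)⁻¹ • M j`. -/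
theorem posSemidef_sum_inv_smul_sub {κ : Type*} [Fintype κ] {M : κ → Matrix m m ℂ}
    (hM : ∀ j, (M j).PosSemidef) (hM1 : ∑ j, M j = 1) {t : κ → ℝ} (ht : ∀ j, 0 < t j)
    {R : Matrix m m ℂ} (hR : R.IsHermitian) (hRt : R * ∑ j, t j • M j = 1) :
    (∑ j, (t j)⁻¹ • M j - R).PosSemidef := by
  have key : ∑ j, (t j)⁻¹ • M j - R =
      ∑ j, (t j)⁻¹ • ((1 - t j • R) * M j * (1 - t j • R)ᴴ) := by
    have h (j : κ) : (t j)⁻¹ • ((1 - t j • R) * M j * (1 - t j • R)ᴴ) =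
        (t j)⁻¹ • M j - R * M j - M j * R + R * (t j • M j) * R := by
      have hj := (ht j).ne'
      rw [conjTranspose_sub, conjTranspose_smul, hR.eq]
      simp only [conjTranspose_one, star_trivial, sub_mul, mul_sub, one_mul, mul_one, smul_sub,
        smul_mul_assoc, mul_smul_comm, smul_smul]
      rw [inv_mul_cancel₀ hj, ← mul_assoc, inv_mul_cancel₀ hj]
      simp only [one_mul, one_smul]
      abel
    simp only [h, Finset.sum_add_distrib, Finset.sum_sub_distrib, ← Finset.mul_sum,
      ← Finset.sum_mul, hM1, hRt]
    simp
  rw [key]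
  exact posSemidef_sum _ fun j _ =>
    ((hM j).mul_mul_conjTranspose_same _).smul (inv_nonneg.2 (ht j).le)

/-- Spectral decomposition of a positive definite matrix. -/
theorem Matrix.PosDef.exists_spectral_decomposition {W : Matrix m m ℂ} (hW : W.PosDef) :
    ∃ (w : m → ℝ) (E : m → Matrix m m ℂ), (∀ i, 0 < w i) ∧ (∀ i, (E i).IsHermitian) ∧
      (∀ i, E i * E i = E i) ∧ (∀ i j, i ≠ j → E i * E j = 0) ∧ ∑ i, E i = 1 ∧
      W = ∑ i, w i • E i := by
  set U := hW.1.eigenvectorUnitary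
  have hU : star (U : Matrix m m ℂ) * U = 1 := Unitary.coe_star_mul_self U
  have hU' : (U : Matrix m m ℂ) * star (U : Matrix m m ℂ) = 1 := Unitary.coe_mul_star_self U
  have hmul (i j : m) : (U * single i i (1 : ℂ) * star (U : Matrix m m ℂ)) *
      (U * single j j (1 : ℂ) * star (U : Matrix m m ℂ)) =
      U * (single i i (1 : ℂ) * single j j (1 : ℂ)) * star (U : Matrix m m ℂ) := by
    calc _ = U * single i i (1 : ℂ) * (star (U : Matrix m m ℂ) * U) * single j j (1 : ℂ) *
          star (U : Matrix m m ℂ) := by simp only [Matrix.mul_assoc]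
      _ = _ := by rw [hU]; simp only [Matrix.mul_assoc, Matrix.one_mul]
  refine ⟨hW.1.eigenvalues, fun i => U * single i i (1 : ℂ) * star (U : Matrix m m ℂ),
    hW.eigenvalues_pos, fun i => ?_, fun i => ?_, fun i j hij => ?_, ?_, ?_⟩
  · exact isHermitian_mul_mul_conjTranspose _ (by simp [IsHermitian])
  · rw [hmul]; simp
  · rw [hmul, single_mul_single_of_ne _ _ _ _ hij]; simp
  · rw [← Finset.sum_mul, ← Finset.mul_sum, sum_single_one, Matrix.mul_one, hU']
  · conv_lhs => rw [hW.1.spectral_theorem, Unitary.conjStarAlgAut_apply]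
    rw [← sum_single_eq_diagonal, Finset.mul_sum, Finset.sum_mul]
    refine Finset.sum_congr rfl fun i _ => ?_
    rw [← smul_mul_assoc, ← mul_smul_comm, smul_single]
    simp [U]

theorem integrableOn_rpow_mul_inv_add {s x : ℝ} (hs : s ∈ Ioo (-1 : ℝ) 0) (hx : 0 < x) :
    IntegrableOn (fun l : ℝ => l ^ s * (l + x)⁻¹) (Ioi 0) ∧
      ∫ l in Ioi 0, l ^ s * (l + x)⁻¹ =
        x ^ s * ∫ l in Ioi 0, Real.rpowIntegrand₀₁ (s + 1) l 1 := by
  have hp : s + 1 ∈ Ioo (0 : ℝ) 1 := ⟨by linarith [hs.1], by linarith [hs.2]⟩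
  have heq : EqOn (fun l => x⁻¹ * Real.rpowIntegrand₀₁ (s + 1) l x)
      (fun l : ℝ => l ^ s * (l + x)⁻¹) (Ioi 0) := fun l hl => by
    simp only [Real.rpowIntegrand₀₁_eq_pow_div hp (le_of_lt hl) hx.le, add_sub_cancel_right]
    field_simp
  have hint : IntegrableOn (fun l => x⁻¹ * Real.rpowIntegrand₀₁ (s + 1) l x) (Ioi 0) :=
    (Real.integrableOn_rpowIntegrand₀₁_Ioi hp hx.le).const_mul _
  refine ⟨hint.congr_fun heq measurableSet_Ioi, ?_⟩
  rw [← setIntegral_congr_fun measurableSet_Ioi heq, integral_const_mul,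
    Real.integral_rpowIntegrand₀₁_eq_rpow_mul_const hp hx.le, Real.rpow_add_one hx.ne']
  field_simp

theorem integrableOn_sum_mul_rpow_mul_inv_add {ι : Type*} [Fintype ι] {s : ℝ} {x : ι → ℝ}
    (hs : s ∈ Ioo (-1 : ℝ) 0) (hx : ∀ i, 0 < x i) (a : ι → ℝ) :
    IntegrableOn (fun l : ℝ => ∑ i, a i * (l ^ s * (l + x i)⁻¹)) (Ioi 0) ∧
      ∫ l in Ioi 0, ∑ i, a i * (l ^ s * (l + x i)⁻¹) =
        (∑ i, a i * x i ^ s) * ∫ l in Ioi 0, Real.rpowIntegrand₀₁ (s + 1) l 1 := by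
  have hint (i : ι) : IntegrableOn (fun l : ℝ => a i * (l ^ s * (l + x i)⁻¹)) (Ioi 0) :=
    (integrableOn_rpow_mul_inv_add hs (hx i)).1.const_mul _
  refine ⟨integrable_finsetSum _ fun i _ => hint i, ?_⟩
  rw [integral_finsetSum _ fun i _ => hint i, Finset.sum_mul]
  refine Finset.sum_congr rfl fun i _ => ?_
  rw [integral_const_mul, (integrableOn_rpow_mul_inv_add hs (hx i)).2, mul_assoc]

/-- An inequality between all resolvents passes to the powers with exponent in `[-1, 0)`. -/
theorem sum_mul_rpow_le_of_sum_mul_inv_le {ι κ : Type*} [Fintype ι] [Fintype κ]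
    {a x : ι → ℝ} {b y : κ → ℝ} (hx : ∀ i, 0 < x i) (hy : ∀ j, 0 < y j)
    (h : ∀ l : ℝ, 0 ≤ l → ∑ i, a i * (l + x i)⁻¹ ≤ ∑ j, b j * (l + y j)⁻¹)
    {s : ℝ} (hs : s ∈ Ico (-1 : ℝ) 0) :
    ∑ i, a i * x i ^ s ≤ ∑ j, b j * y j ^ s := by
  obtain rfl | hs1 := hs.1.eq_or_lt
  · simpa [Real.rpow_neg_one] using h 0 le_rfl
  have hs' : s ∈ Ioo (-1 : ℝ) 0 := ⟨hs1, hs.2⟩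
  set C := ∫ l in Ioi 0, Real.rpowIntegrand₀₁ (s + 1) l 1
  have hC : 0 < C :=
    Real.integral_rpowIntegrand₀₁_one_pos ⟨by linarith [hs1], by linarith [hs.2]⟩
  obtain ⟨hix, hvx⟩ := integrableOn_sum_mul_rpow_mul_inv_add hs' hx a
  obtain ⟨hiy, hvy⟩ := integrableOn_sum_mul_rpow_mul_inv_add hs' hy b
  have hle := setIntegral_mono_on hix hiy measurableSet_Ioi fun l hl => ?_
  · rw [hvx, hvy] at hle
    exact le_of_mul_le_mul_right hle hC
  · simpa only [Finset.mul_sum, mul_left_comm] using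
      mul_le_mul_of_nonneg_left (h l (le_of_lt hl)) (Real.rpow_nonneg (le_of_lt hl) s)

theorem posDef_sum_smul {n : Type*} [DecidableEq n] {κ : Type*} [Fintype κ] {M : κ → Matrix n n ℂ}
    (hM : ∀ j, (M j).PosSemidef) (hM1 : ∑ j, M j = 1) {t : κ → ℝ} (ht : ∀ j, 0 < t j) :
    (∑ j, t j • M j).PosDef := by
  have hnonneg (j : κ) : 0 ≤ (t j)⁻¹ := (inv_pos.2 (ht j)).le
  set c : ℝ := (∑ j, (t j)⁻¹ + 1)⁻¹
  have hc : 0 < c :=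
    inv_pos.2 (by linarith [Finset.sum_nonneg fun j (_ : j ∈ Finset.univ) => hnonneg j])
  have hct (j : κ) : c ≤ t j := by
    refine inv_le_of_inv_le₀ (ht j) ?_
    linarith [Finset.single_le_sum (fun j _ => hnonneg j) (Finset.mem_univ j)]
  have h : ∑ j, t j • M j = c • (1 : Matrix n n ℂ) + ∑ j, (t j - c) • M j := by
    simp [sub_smul, Finset.sum_sub_distrib, ← Finset.smul_sum, hM1]
  rw [h]
  exact (PosDef.one.smul hc).add_posSemidef
    (posSemidef_sum _ fun j _ => (hM j).smul (sub_nonneg.2 (hct j)))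

/-- Operator Jensen inequality for `x ↦ x ^ s` with `s ∈ [-1, 0)`: the operator `∑ j, t j • M j`
of a POVM `M` has a spectral measure `E`, with eigenvalues `w`, such that the expectation of
`∑ i, w i ^ s • E i` in any state is at most that of `∑ j, t j ^ s • M j`. -/
theorem exists_spectral_sum_rpow_le {κ : Type*} [Fintype κ] {M : κ → Matrix m m ℂ}
    (hM : ∀ j, (M j).PosSemidef) (hM1 : ∑ j, M j = 1) {t : κ → ℝ} (ht : ∀ j, 0 < t j) :
    ∃ (w : m → ℝ) (E : m → Matrix m m ℂ), (∀ i, 0 < w i) ∧ (∀ i, (E i).IsHermitian) ∧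
      (∀ i, E i * E i = E i) ∧ (∀ i j, i ≠ j → E i * E j = 0) ∧ ∑ i, E i = 1 ∧
      ∑ j, t j • M j = ∑ i, w i • E i ∧
      ∀ ρ : Matrix m m ℂ, ρ.PosSemidef → ∀ s ∈ Ico (-1 : ℝ) 0,
        ∑ i, (ρ * E i).trace.re * w i ^ s ≤ ∑ j, (ρ * M j).trace.re * t j ^ s := by
  obtain ⟨w, E, hw, herm, idem, orth, hE1, hWE⟩ :=
    (posDef_sum_smul hM hM1 ht).exists_spectral_decomposition
  refine ⟨w, E, hw, herm, idem, orth, hE1, hWE, fun ρ hρ s hs =>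
    sum_mul_rpow_le_of_sum_mul_inv_le hw ht (fun l hl => ?_) hs⟩
  have hlw (i : m) : 0 < l + w i := add_pos_of_nonneg_of_pos hl (hw i)
  have hlt (j : κ) : 0 < l + t j := add_pos_of_nonneg_of_pos hl (ht j)
  have hsum : ∑ j, (l + t j) • M j = ∑ i, (l + w i) • E i := by
    simp only [add_smul, Finset.sum_add_distrib, ← Finset.smul_sum, hM1, hE1, hWE]
  have hinv : (∑ i, (l + w i)⁻¹ • E i) * ∑ j, (l + t j) • M j = 1 := by
    rw [hsum, ← hE1, Finset.sum_mul]
    refine Finset.sum_congr rfl fun i _ => ?_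
    rw [Finset.mul_sum, Finset.sum_eq_single i (fun k _ hk => by simp [orth i k hk.symm]) (by simp)]
    simp [idem, smul_smul, (hlw i).ne']
  have hR : (∑ i, (l + w i)⁻¹ • E i).IsHermitian := by
    simp only [IsHermitian, conjTranspose_sum, conjTranspose_smul, (herm _).eq, star_trivial]
  have h := hρ.re_trace_mul_nonneg (posSemidef_sum_inv_smul_sub hM hM1 hlt hR hinv)
  simp only [Matrix.mul_sub, Matrix.mul_sum, Matrix.mul_smul, trace_sub, trace_sum, trace_smul,
    Complex.sub_re, Complex.re_sum, Complex.real_smul, Complex.re_ofReal_mul] at h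
  simpa only [mul_comm] using sub_nonneg.1 h

theorem Real.rpow_mul_rpow_one_sub_le {α a b t : ℝ} (hα : 0 < α) (hα1 : α ≤ 1) (ha : 0 ≤ a)
    (hb : 0 ≤ b) (ht : 0 < t) :
    a ^ α * b ^ (1 - α) ≤ α * (a * t ^ (1 - 1 / α)) + (1 - α) * (b * t) := by
  refine le_of_eq_of_le ?_ (Real.geom_mean_le_arith_mean2_weighted hα.le (sub_nonneg.2 hα1)
    (mul_nonneg ha (Real.rpow_nonneg ht.le _)) (mul_nonneg hb ht.le) (by ring))
  rw [Real.mul_rpow ha (Real.rpow_nonneg ht.le _), Real.mul_rpow hb ht.le, ← Real.rpow_mul ht.le,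
    mul_mul_mul_comm, ← Real.rpow_add ht]
  have : (1 - 1 / α) * α + (1 - α) = 0 := by field_simp; ring
  rw [this, Real.rpow_zero, mul_one]

theorem Real.weighted_add_div_rpow_eq {α a b : ℝ} (hα : 0 < α) (ha : 0 < a) (hb : 0 < b) :
    α * (a * ((a / b) ^ α) ^ (1 - 1 / α)) + (1 - α) * (b * (a / b) ^ α) =
      a ^ α * b ^ (1 - α) := by
  have hs : α * (1 - 1 / α) = α - 1 := by field_simp
  rw [← Real.rpow_mul (div_pos ha hb).le, hs, Real.rpow_sub_one (div_pos ha hb).ne',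
    Real.div_rpow ha.le hb.le, Real.rpow_sub hb, Real.rpow_one]
  field_simp
  ring

theorem Qmeas_le_sum_of_povm_of_pos {ρ σ : Matrix m m ℂ} (hρ : ρ.PosSemidef) (hσ : σ.PosSemidef)
    {α : ℝ} (hα : α ∈ Ico (1 / 2 : ℝ) 1) {κ : Type*} [Fintype κ] {M : κ → Matrix m m ℂ}
    (hM : ∀ j, (M j).PosSemidef) (hM1 : ∑ j, M j = 1) {t : κ → ℝ} (ht : ∀ j, 0 < t j) :
    Qmeas α ρ σ ≤ ∑ j, (α * ((ρ * M j).trace.re * t j ^ (1 - 1 / α)) +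
      (1 - α) * ((σ * M j).trace.re * t j)) := by
  have hα0 : 0 < α := by linarith [hα.1]
  have hs : 1 - 1 / α ∈ Ico (-1 : ℝ) 0 := by
    have h1 : 1 / α ≤ 2 := (div_le_iff₀ hα0).2 (by linarith [hα.1])
    have h2 : 1 < 1 / α := (one_lt_div hα0).2 hα.2
    exact ⟨by linarith, by linarith⟩
  obtain ⟨w, E, hw, herm, idem, orth, hE1, hWE, hle⟩ := exists_spectral_sum_rpow_le hM hM1 ht
  obtain ⟨Λ, hΛ⟩ := exists_pvm_measVal_eq E herm idem orth hE1
  have hE (i : m) : (E i).PosSemidef := (herm i).posSemidef_of_idem (idem i)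
  have hq : ∑ i, (σ * E i).trace.re * w i = ∑ j, (σ * M j).trace.re * t j := by
    have h := congrArg (fun A => (σ * A).trace.re) hWE
    simp only [Matrix.mul_sum, Matrix.mul_smul, trace_sum, trace_smul, Complex.re_sum,
      Complex.real_smul, Complex.re_ofReal_mul] at h
    simpa only [mul_comm] using h.symm
  calc Qmeas α ρ σ ≤ measVal α ρ σ Λ := Qmeas_le_measVal hρ hσ α Λ
    _ ≤ ∑ i, (α * ((ρ * E i).trace.re * w i ^ (1 - 1 / α)) +
        (1 - α) * ((σ * E i).trace.re * w i)) := by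
      rw [hΛ]
      exact Finset.sum_le_sum fun i _ => Real.rpow_mul_rpow_one_sub_le hα0 hα.2.le
        (hρ.re_trace_mul_nonneg (hE i)) (hσ.re_trace_mul_nonneg (hE i)) (hw i)
    _ ≤ _ := by
      simp only [Finset.sum_add_distrib, ← Finset.mul_sum, hq]
      gcongr
      exact hle ρ hρ _ hs

/-- For `α ∈ [1/2, 1)` general measurements do not improve on projective ones. -/
theorem Qmeas_le_sum_of_povm {ρ σ : Matrix m m ℂ} (hρ : ρ.PosSemidef) (hσ : σ.PosSemidef)
    {α : ℝ} (hα : α ∈ Ico (1 / 2 : ℝ) 1) {κ : Type*} [Fintype κ] {M : κ → Matrix m m ℂ}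
    (hM : ∀ j, (M j).PosSemidef) (hM1 : ∑ j, M j = 1) :
    Qmeas α ρ σ ≤ ∑ j, (ρ * M j).trace.re ^ α * (σ * M j).trace.re ^ (1 - α) := by
  have hα0 : 0 < α := by linarith [hα.1]
  have hp (j : κ) := hρ.re_trace_mul_nonneg (hM j)
  have hq (j : κ) := hσ.re_trace_mul_nonneg (hM j)
  have hcont : Continuous fun δ : ℝ =>
      ∑ j, ((ρ * M j).trace.re + δ) ^ α * ((σ * M j).trace.re + δ) ^ (1 - α) := by
    refine continuous_finsetSum _ fun j _ => .mul ?_ ?_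
    · exact (continuous_const.add continuous_id).rpow_const fun _ => .inr hα0.le
    · exact (continuous_const.add continuous_id).rpow_const fun _ => .inr (by linarith [hα.2])
  have hlim := (hcont.tendsto 0).mono_left (nhdsWithin_le_nhds (s := Ioi 0))
  simp only [add_zero] at hlim
  refine ge_of_tendsto hlim ?_
  filter_upwards [self_mem_nhdsWithin] with δ hδ
  have hδ : 0 < δ := hδ
  have hpδ (j : κ) : 0 < (ρ * M j).trace.re + δ := add_pos_of_nonneg_of_pos (hp j) hδ
  have hqδ (j : κ) : 0 < (σ * M j).trace.re + δ := add_pos_of_nonneg_of_pos (hq j) hδ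
  have ht (j : κ) := Real.rpow_pos_of_pos (div_pos (hpδ j) (hqδ j)) α
  refine (Qmeas_le_sum_of_povm_of_pos hρ hσ hα hM hM1 ht).trans (Finset.sum_le_sum fun j _ => ?_)
  rw [← Real.weighted_add_div_rpow_eq hα0 (hpδ j) (hqδ j)]
  have h1 : 0 ≤ 1 - α := by linarith [hα.2]
  have h2 := (Real.rpow_pos_of_pos (ht j) (1 - 1 / α)).le
  have h3 := (ht j).le
  gcongr <;> linarith

/-- Hölder's inequality with exponents `α` and `1 - α`. -/
theorem Real.sum_rpow_mul_rpow_one_sub_le {ι : Type*} (s : Finset ι) {a b : ι → ℝ}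
    (ha : ∀ i, 0 ≤ a i) (hb : ∀ i, 0 ≤ b i) {α : ℝ} (hα : 0 < α) (hα1 : α < 1) :
    ∑ i ∈ s, a i ^ α * b i ^ (1 - α) ≤ (∑ i ∈ s, a i) ^ α * (∑ i ∈ s, b i) ^ (1 - α) := by
  have hβ : 0 < 1 - α := sub_pos.2 hα1
  have hpq : Real.HolderConjugate α⁻¹ (1 - α)⁻¹ :=
    Real.holderConjugate_iff.2 ⟨(one_lt_inv₀ hα).2 hα1, by simp⟩
  have h := Real.inner_le_Lp_mul_Lq_of_nonneg s hpq
    (fun i _ => Real.rpow_nonneg (ha i) α) (fun i _ => Real.rpow_nonneg (hb i) (1 - α))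
  simpa only [← Real.rpow_mul (ha _), ← Real.rpow_mul (hb _), mul_inv_cancel₀ hα.ne',
    mul_inv_cancel₀ hβ.ne', Real.rpow_one, one_div, inv_inv] using h

theorem Real.mul_rpow_mul_mul_rpow_one_sub {c a b : ℝ} (hc : 0 ≤ c) (ha : 0 ≤ a) (hb : 0 ≤ b)
    (α : ℝ) : (c * a) ^ α * (c * b) ^ (1 - α) = c * (a ^ α * b ^ (1 - α)) := by
  rw [Real.mul_rpow hc ha, Real.mul_rpow hc hb, mul_mul_mul_comm,
    ← Real.rpow_add' hc (by simp), add_sub_cancel, Real.rpow_one]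

open scoped Kronecker

section ClassicalQuantum

variable {X : Type*} [Fintype X] [DecidableEq X]

theorem cqState_posSemidef {n : Type*} [Fintype n] {P : X → ℝ} (hP : ∀ x, 0 ≤ P x)
    {ρ : X → Matrix n n ℂ}
    (hρ : ∀ x, (ρ x).PosSemidef) : (cqState P ρ).PosSemidef := by
  have h : cqState P ρ = ∑ x, P x • (single x x (1 : ℂ) ⊗ₖ ρ x) := by
    ext ⟨x, i⟩ ⟨y, j⟩
    simp only [cqState, of_apply, Matrix.sum_apply, Matrix.smul_apply, kroneckerMap_apply,
      single_apply]
    rw [Finset.sum_eq_single x (fun z _ hz => by simp [hz]) (by simp)]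
    split_ifs <;> simp_all
  rw [h]
  refine posSemidef_sum _ fun x _ => .smul (.kronecker ?_ (hρ x)) (hP x)
  exact IsHermitian.posSemidef_of_idem (by simp [IsHermitian]) (by simp)

theorem re_trace_cqState_mul {n : Type*} [Fintype n] (P : X → ℝ) (ρ : X → Matrix n n ℂ)
    (A : Matrix (X × n) (X × n) ℂ) :
    (cqState P ρ * A).trace.re =
      ∑ x, P x * (ρ x * A.submatrix (Prod.mk x) (Prod.mk x)).trace.re := by
  simp only [trace, diag_apply, mul_apply, Fintype.sum_prod_type, cqState, of_apply, ite_mul,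
    zero_mul, submatrix_apply, Complex.re_sum, Finset.mul_sum]
  refine Finset.sum_congr rfl fun x _ => Finset.sum_congr rfl fun i _ => ?_
  rw [Finset.sum_eq_single x (fun y _ hy => by simp [hy.symm]) (by simp)]
  simp [mul_assoc]

theorem re_trace_cqState_mul_kronecker (P : X → ℝ) (ρ : X → Matrix m m ℂ) (x : X)
    (A : Matrix m m ℂ) :
    (cqState P ρ * (single x x (1 : ℂ) ⊗ₖ A)).trace.re = P x * (ρ x * A).trace.re := by
  have h (y : X) : (single x x (1 : ℂ) ⊗ₖ A).submatrix (Prod.mk y) (Prod.mk y) =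
      if x = y then A else 0 := by
    ext i j
    by_cases hxy : x = y <;> simp [kroneckerMap_apply, hxy]
  rw [re_trace_cqState_mul, Finset.sum_eq_single x (fun y _ hy => by simp [h, hy.symm]) (by simp)]
  simp [h]

/-- A family of conditional measurements yields a joint measurement, controlled by the classical
register. -/
theorem exists_pvm_measVal_cqState_eq (Λ : X → PVM m) {P : X → ℝ} (hP : ∀ x, 0 ≤ P x)
    {ρ σ : X → Matrix m m ℂ} (hρ : ∀ x, (ρ x).PosSemidef) (hσ : ∀ x, (σ x).PosSemidef) (α : ℝ) :
    ∃ Γ : PVM (X × m), measVal α (cqState P ρ) (cqState P σ) Γ =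
      ∑ x, P x * measVal α (ρ x) (σ x) (Λ x) := by
  let E (i : (x : X) × Fin (Λ x).k) : Matrix (X × m) (X × m) ℂ :=
    single i.1 i.1 (1 : ℂ) ⊗ₖ (Λ i.1).P i.2
  have herm (i) : (E i).IsHermitian := by
    simp [E, IsHermitian, conjTranspose_kronecker, ((Λ i.1).herm i.2).eq]
  have idem (i) : E i * E i = E i := by simp [E, ← mul_kronecker_mul, (Λ i.1).idem]
  have orth : ∀ i j, i ≠ j → E i * E j = 0 := by
    rintro ⟨x, i⟩ ⟨y, j⟩ hij
    simp only [E, ← mul_kronecker_mul]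
    obtain rfl | hxy := eq_or_ne x y
    · rw [(Λ x).orth i j (by rintro rfl; exact hij rfl), kronecker_zero]
    · rw [single_mul_single_of_ne _ _ _ _ hxy, zero_kronecker]
  have sum_eq : ∑ i, E i = 1 := by
    rw [Fintype.sum_sigma]
    calc _ = ∑ x : X, single x x (1 : ℂ) ⊗ₖ (1 : Matrix m m ℂ) := by
          refine Finset.sum_congr rfl fun x _ => ?_
          rw [← (Λ x).sum_eq]
          exact (map_sum (kroneckerBilinear (R := ℂ) (single x x (1 : ℂ))) _ _).symm
      _ = (∑ x : X, single x x (1 : ℂ)) ⊗ₖ (1 : Matrix m m ℂ) :=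
          (map_sum (kroneckerBilinear (R := ℂ) |>.flip (1 : Matrix m m ℂ)) _ _).symm
      _ = 1 := by rw [sum_single_one, one_kronecker_one]
  obtain ⟨Γ, hΓ⟩ := exists_pvm_measVal_eq E herm idem orth sum_eq
  refine ⟨Γ, ?_⟩
  rw [hΓ, Fintype.sum_sigma]
  refine Finset.sum_congr rfl fun x _ => ?_
  rw [measVal, Finset.mul_sum]
  refine Finset.sum_congr rfl fun j _ => ?_
  rw [re_trace_cqState_mul_kronecker, re_trace_cqState_mul_kronecker,
    Real.mul_rpow_mul_mul_rpow_one_sub (hP x)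
      ((hρ x).re_trace_mul_nonneg ((Λ x).posSemidef j))
      ((hσ x).re_trace_mul_nonneg ((Λ x).posSemidef j))]

theorem sum_mul_Qmeas_le_measVal_cqState {P : X → ℝ} (hP : ∀ x, 0 ≤ P x)
    {ρ σ : X → Matrix m m ℂ} (hρ : ∀ x, (ρ x).PosSemidef) (hσ : ∀ x, (σ x).PosSemidef)
    {α : ℝ} (hα : α ∈ Ico (1 / 2 : ℝ) 1) (Λ : PVM (X × m)) :
    ∑ x, P x * Qmeas α (ρ x) (σ x) ≤ measVal α (cqState P ρ) (cqState P σ) Λ := by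
  have hα0 : 0 < α := by linarith [hα.1]
  let M (x : X) (j : Fin Λ.k) : Matrix m m ℂ := (Λ.P j).submatrix (Prod.mk x) (Prod.mk x)
  have hM (x : X) (j : Fin Λ.k) : (M x j).PosSemidef := (Λ.posSemidef j).submatrix _
  have hM1 (x : X) : ∑ j, M x j = 1 := by
    ext a b
    have h := congrFun (congrFun Λ.sum_eq (x, a)) (x, b)
    simpa [M, Matrix.sum_apply, one_apply] using h
  have hp (x : X) (j : Fin Λ.k) := (hρ x).re_trace_mul_nonneg (hM x j)
  have hq (x : X) (j : Fin Λ.k) := (hσ x).re_trace_mul_nonneg (hM x j)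
  calc ∑ x, P x * Qmeas α (ρ x) (σ x)
      ≤ ∑ x, P x * ∑ j, (ρ x * M x j).trace.re ^ α * (σ x * M x j).trace.re ^ (1 - α) :=
        Finset.sum_le_sum fun x _ => mul_le_mul_of_nonneg_left
          (Qmeas_le_sum_of_povm (hρ x) (hσ x) hα (hM x) (hM1 x)) (hP x)
    _ = ∑ j, ∑ x, (P x * (ρ x * M x j).trace.re) ^ α *
          (P x * (σ x * M x j).trace.re) ^ (1 - α) := by
        rw [Finset.sum_comm]
        refine Finset.sum_congr rfl fun x _ => ?_
        rw [Finset.mul_sum]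
        exact Finset.sum_congr rfl fun j _ =>
          (Real.mul_rpow_mul_mul_rpow_one_sub (hP x) (hp x j) (hq x j) α).symm
    _ ≤ measVal α (cqState P ρ) (cqState P σ) Λ := by
        refine Finset.sum_le_sum fun j _ => ?_
        rw [re_trace_cqState_mul, re_trace_cqState_mul]
        exact Real.sum_rpow_mul_rpow_one_sub_le _ (fun x => mul_nonneg (hP x) (hp x j))
          (fun x => mul_nonneg (hP x) (hq x j)) hα0 hα.2

end ClassicalQuantum

/-- For a classical-quantum state `ρ_{XB} = ∑_x P(x)|x⟩⟨x| ⊗ ρ_x`,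
`Q̌_α(ρ_{XB} ‖ P_X ⊗ σ_B) = ∑_x P(x) Q̌_α(ρ_x ‖ σ_B)`. -/
theorem Qmeas_cq {X : Type*} [Fintype X] [DecidableEq X]
    (P : X → ℝ) (hP : ∀ x, 0 ≤ P x) (hP1 : ∑ x, P x = 1)
    (ρ : X → Matrix m m ℂ) (hρ : ∀ x, (ρ x).PosSemidef) (hρt : ∀ x, (ρ x).trace = 1)
    (σ : Matrix m m ℂ) (hσ : σ.PosSemidef) (hσt : σ.trace = 1)
    (α : ℝ) (hα : α ∈ Set.Ico (1/2 : ℝ) 1) :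
    Qmeas α (cqState P ρ) (cqState P fun _ => σ) = ∑ x, P x * Qmeas α (ρ x) σ := by
  have hσ' : ∀ _ : X, σ.PosSemidef := fun _ => hσ
  refine le_antisymm (le_of_forall_pos_le_add fun ε hε => ?_)
    (le_Qmeas (sum_mul_Qmeas_le_measVal_cqState hP hρ hσ' hα))
  choose Λ hΛ using fun x => exists_measVal_lt_Qmeas_add (ρ x) σ α hε
  obtain ⟨Γ, hΓ⟩ := exists_pvm_measVal_cqState_eq Λ hP hρ hσ' α
  calc Qmeas α (cqState P ρ) (cqState P fun _ => σ)
      ≤ ∑ x, P x * measVal α (ρ x) σ (Λ x) :=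
        hΓ ▸ Qmeas_le_measVal (cqState_posSemidef hP hρ) (cqState_posSemidef hP hσ') α Γ
    _ ≤ ∑ x, P x * (Qmeas α (ρ x) σ + ε) :=
        Finset.sum_le_sum fun x _ => mul_le_mul_of_nonneg_left (hΛ x).le (hP x)
    _ = ∑ x, P x * Qmeas α (ρ x) σ + ε := by
        simp only [mul_add, Finset.sum_add_distrib, ← Finset.sum_mul, hP1, one_mul]
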